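/- Let w ∈ ℝ with w < λ_min(A), and let f : ℂ → ℂ be complex differentiable on an open set containing the closed disk centered at λ_max(A) of radius λ_max(A) − w. Let M be an n×n Hermitian positive definite matrix commuting with A and set ‖v‖_M := √(vᴴ M v). Then ‖f(A)b − Q f(T) Qᴴ b‖_M ≤ ( (1/(2π)) ∮_{|z−λ_max(A)| = λ_max(A)−w} |f(z)| |dz| ) · ‖err_k(w)‖_M ≤ ( (λ_max(A) − w) · max_{|z−λ_max(A)| = λ_max(A)−w} |f(z)| ) · ‖err_k(w)‖_M, where the integral is the arclength integral over the circle centered at λ_max(A) with radius λ_max(A) − w. -/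

import Mathlib

open Matrix MeasureTheory

/-- The Euclidean 2-norm of a complex vector. -/
noncomputable def norm2 {n : ℕ} (v : Fin n → ℂ) : ℝ :=
  Real.sqrt (∑ i, ‖v i‖ ^ 2)
open scoped ComplexOrder

/-- Apply a scalar function to a Hermitian matrix through its spectral decomposition. -/
noncomputable def matFun {m : ℕ} {B : Matrix (Fin m) (Fin m) ℂ}
    (hB : B.IsHermitian) (f : ℝ → ℂ) : Matrix (Fin m) (Fin m) ℂ :=
  (hB.eigenvectorUnitary : Matrix (Fin m) (Fin m) ℂ) *
    Matrix.diagonal (fun i => f (hB.eigenvalues i)) *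
    star (hB.eigenvectorUnitary : Matrix (Fin m) (Fin m) ℂ)

/-- The Lanczos-FA error for the shifted linear system `(A - z I) x = b`. -/
noncomputable def errK {n k : ℕ} (A : Matrix (Fin n) (Fin n) ℂ) (Q : Matrix (Fin n) (Fin k) ℂ)
    (T : Matrix (Fin k) (Fin k) ℂ) (b : Fin n → ℂ) (z : ℂ) : Fin n → ℂ :=
  (A - z • 1)⁻¹.mulVec b - (Q * (T - z • 1)⁻¹ * Qᴴ).mulVec b

/-- The Lanczos-FA residual for the shifted linear system `(A - z I) x = b`. -/
noncomputable def resK {n k : ℕ} (A : Matrix (Fin n) (Fin n) ℂ) (Q : Matrix (Fin n) (Fin k) ℂ)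
    (T : Matrix (Fin k) (Fin k) ℂ) (b : Fin n → ℂ) (z : ℂ) : Fin n → ℂ :=
  b - ((A - z • 1) * (Q * (T - z • 1)⁻¹ * Qᴴ)).mulVec b

/-- The norm induced by a positive definite matrix `M`: `‖v‖_M = sqrt (vᴴ M v)`. -/
noncomputable def normM {n : ℕ} (M : Matrix (Fin n) (Fin n) ℂ) (v : Fin n → ℂ) : ℝ :=
  Real.sqrt ((star v ⬝ᵥ M.mulVec v).re)


section SpectralCalculus

variable {m : ℕ} {B : Matrix (Fin m) (Fin m) ℂ}

theorem matFun_mul (hB : B.IsHermitian) (f g : ℝ → ℂ) :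
    matFun hB f * matFun hB g = matFun hB (fun x => f x * g x) := by
  have hU : star (hB.eigenvectorUnitary : Matrix (Fin m) (Fin m) ℂ) *
      (hB.eigenvectorUnitary : Matrix (Fin m) (Fin m) ℂ) = 1 :=
    Unitary.coe_star_mul_self _
  simp only [matFun, Matrix.mul_assoc]
  rw [← Matrix.mul_assoc (star _) (hB.eigenvectorUnitary : Matrix (Fin m) (Fin m) ℂ), hU,
    Matrix.one_mul, ← Matrix.mul_assoc (diagonal _) (diagonal _), diagonal_mul_diagonal]

theorem sub_smul_one_eq_matFun (hB : B.IsHermitian) (z : ℂ) :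
    B - z • 1 = matFun hB (fun x => x - z) := by
  have hU : (hB.eigenvectorUnitary : Matrix (Fin m) (Fin m) ℂ) *
      star (hB.eigenvectorUnitary : Matrix (Fin m) (Fin m) ℂ) = 1 :=
    Unitary.coe_mul_star_self _
  have hd : (diagonal fun i => (hB.eigenvalues i : ℂ) - z) =
      diagonal (RCLike.ofReal ∘ hB.eigenvalues) - z • (1 : Matrix (Fin m) (Fin m) ℂ) := by
    rw [← diagonal_one, ← diagonal_smul, diagonal_sub]
    congr 1
    ext i
    simp
  conv_lhs => rw [hB.spectral_theorem, Unitary.conjStarAlgAut_apply]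
  rw [matFun, hd, Matrix.mul_sub, Matrix.sub_mul, mul_smul_comm, smul_mul_assoc, Matrix.mul_one,
    hU]

theorem matFun_one (hB : B.IsHermitian) : matFun hB (fun _ => 1) = 1 := by
  simp [matFun]

theorem inv_sub_smul_one_eq_matFun (hB : B.IsHermitian) {z : ℂ}
    (hz : ∀ i, (hB.eigenvalues i : ℂ) - z ≠ 0) :
    (B - z • 1)⁻¹ = matFun hB (fun x => (x - z)⁻¹) := by
  refine Matrix.inv_eq_right_inv ?_
  rw [sub_smul_one_eq_matFun hB, matFun_mul, ← matFun_one hB]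
  simp only [matFun]
  congr 3
  ext i
  exact mul_inv_cancel₀ (hz i)

theorem det_sub_smul_one (hB : B.IsHermitian) (z : ℂ) :
    (B - z • 1).det = ∏ i, ((hB.eigenvalues i : ℂ) - z) := by
  have hU : (hB.eigenvectorUnitary : Matrix (Fin m) (Fin m) ℂ) *
      star (hB.eigenvectorUnitary : Matrix (Fin m) (Fin m) ℂ) = 1 :=
    Unitary.coe_mul_star_self _
  rw [sub_smul_one_eq_matFun hB, matFun, det_mul_right_comm, hU, Matrix.one_mul, det_diagonal]

theorem isUnit_det_sub_smul_one (hB : B.IsHermitian) {z : ℂ}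
    (hz : ∀ i, (hB.eigenvalues i : ℂ) - z ≠ 0) : IsUnit (B - z • 1).det := by
  rw [det_sub_smul_one hB, isUnit_iff_ne_zero]
  exact Finset.prod_ne_zero_iff.mpr fun i _ => hz i

/-- The spectral calculus applied to a vector is a sum over eigenvectors. -/
theorem matFun_mulVec_eq_sum (hB : B.IsHermitian) (f : ℝ → ℂ) (v : Fin m → ℂ) :
    matFun hB f *ᵥ v = ∑ i, f (hB.eigenvalues i) •
      ((star (hB.eigenvectorUnitary : Matrix (Fin m) (Fin m) ℂ) *ᵥ v) i •
        (hB.eigenvectorUnitary : Matrix (Fin m) (Fin m) ℂ).col i) := by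
  ext j
  simp only [matFun, ← mulVec_mulVec]
  simp [mulVec, dotProduct, diagonal_apply, Finset.sum_apply, mul_comm, mul_left_comm]

theorem star_dotProduct_self_eq_norm_sq (v : Fin m → ℂ) :
    star v ⬝ᵥ v = ((‖WithLp.toLp 2 v‖ ^ 2 : ℝ) : ℂ) := by
  have h := inner_self_eq_norm_sq_to_K (𝕜 := ℂ) (WithLp.toLp 2 v)
  rw [EuclideanSpace.inner_eq_star_dotProduct, dotProduct_comm] at h
  rw [Complex.ofReal_pow]
  exact h

/-- A matrix with orthonormal columns acts isometrically. -/
theorem norm_toLp_mulVec_of_conjTranspose_mul_self {n : ℕ} {Q : Matrix (Fin n) (Fin m) ℂ}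
    (hQ : Qᴴ * Q = 1) (v : Fin m → ℂ) :
    ‖WithLp.toLp 2 (Q *ᵥ v)‖ = ‖WithLp.toLp 2 v‖ := by
  refine (sq_eq_sq₀ (norm_nonneg _) (norm_nonneg _)).1 ?_
  rw [← Complex.ofReal_inj, ← star_dotProduct_self_eq_norm_sq, ← star_dotProduct_self_eq_norm_sq,
    star_mulVec, dotProduct_mulVec, vecMul_vecMul, hQ, vecMul_one]

theorem norm_toLp_sub_smul_one_mulVec_sq (hB : B.IsHermitian) (z : ℂ) (v : Fin m → ℂ) :
    ‖WithLp.toLp 2 ((B - z • 1) *ᵥ v)‖ ^ 2 = ∑ i, (‖(hB.eigenvalues i : ℂ) - z‖ *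
      ‖(star (hB.eigenvectorUnitary : Matrix (Fin m) (Fin m) ℂ) *ᵥ v) i‖) ^ 2 := by
  rw [sub_smul_one_eq_matFun hB, matFun, Matrix.mul_assoc, ← mulVec_mulVec,
    norm_toLp_mulVec_of_conjTranspose_mul_self (Unitary.coe_star_mul_self _), EuclideanSpace.norm_sq_eq]
  refine Finset.sum_congr rfl fun i _ => ?_
  rw [← mulVec_mulVec]
  simp [mulVec_diagonal]

theorem norm_toLp_sub_smul_one_mulVec_mono (hB : B.IsHermitian) {z w : ℂ}
    (h : ∀ i, ‖(hB.eigenvalues i : ℂ) - w‖ ≤ ‖(hB.eigenvalues i : ℂ) - z‖) (v : Fin m → ℂ) :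
    ‖WithLp.toLp 2 ((B - w • 1) *ᵥ v)‖ ≤ ‖WithLp.toLp 2 ((B - z • 1) *ᵥ v)‖ := by
  refine (sq_le_sq₀ (norm_nonneg _) (norm_nonneg _)).1 ?_
  rw [norm_toLp_sub_smul_one_mulVec_sq hB, norm_toLp_sub_smul_one_mulVec_sq hB]
  gcongr with i
  exact h i

end SpectralCalculus

open scoped MatrixOrder Matrix.Norms.L2Operator in
theorem exists_conjTranspose_mul_self_commute {n : ℕ} {M A : Matrix (Fin n) (Fin n) ℂ}
    (hM : M.PosSemidef) (hMA : Commute M A) :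
    ∃ R : Matrix (Fin n) (Fin n) ℂ, Rᴴ * R = M ∧ Commute R A := by
  have h0 : 0 ≤ M := hM.nonneg
  refine ⟨CFC.sqrt M, ?_, ?_⟩
  · rw [← star_eq_conjTranspose, (CFC.sqrt_nonneg M).isSelfAdjoint.star_eq]
    exact CFC.sqrt_mul_sqrt_self M h0
  · exact hMA.cfcₙ_nnreal _

theorem norm_toLp_mulVec_eq_normM {n : ℕ} (R : Matrix (Fin n) (Fin n) ℂ) (v : Fin n → ℂ) :
    ‖WithLp.toLp 2 (R *ᵥ v)‖ = normM (Rᴴ * R) v := by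
  rw [normM, ← mulVec_mulVec, dotProduct_mulVec, ← star_mulVec, star_dotProduct_self_eq_norm_sq,
    Complex.ofReal_re, Real.sqrt_sq (norm_nonneg _)]

/-- The corner entry of the adjugate of a shifted tridiagonal matrix does not depend on the shift. -/
theorem adjugate_corner_sub_smul_one {k : ℕ} (hk : 0 < k) {S : Matrix (Fin k) (Fin k) ℂ}
    (hS : ∀ i j : Fin k, (j : ℕ) + 1 < (i : ℕ) → S i j = 0) (z w : ℂ) :
    (S - z • 1).adjugate ⟨k - 1, Nat.sub_lt hk Nat.one_pos⟩ ⟨0, hk⟩ =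
      (S - w • 1).adjugate ⟨k - 1, Nat.sub_lt hk Nat.one_pos⟩ ⟨0, hk⟩ := by
  obtain ⟨m, rfl⟩ : ∃ m, k = m + 1 := ⟨k - 1, by omega⟩
  have h1 : (⟨m + 1 - 1, Nat.sub_lt hk Nat.one_pos⟩ : Fin (m + 1)) = Fin.last m := rfl
  have h2 : (⟨0, hk⟩ : Fin (m + 1)) = 0 := rfl
  have key : ∀ z : ℂ, ((S - z • 1).submatrix (Fin.succAbove 0) (Fin.last m).succAbove).det =
      ∏ i : Fin m, S i.succ i.castSucc := by
    intro z
    rw [det_of_isUpperTriangular]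
    · refine Finset.prod_congr rfl fun i _ => ?_
      simp [Fin.ext_iff]
    · intro i j hij
      have hij' : (j : ℕ) < i := hij
      have hne : i.succ ≠ j.castSucc := by
        simp only [ne_eq, Fin.ext_iff, Fin.val_succ, Fin.val_castSucc]
        omega
      have : S i.succ j.castSucc = 0 := hS _ _ (by simpa using hij')
      simp [this, hne]
  rw [h1, h2, adjugate_fin_succ_eq_det_submatrix, adjugate_fin_succ_eq_det_submatrix, key, key]

/-- Bounds on the eigenvalues of `A` carry over to its compression by orthonormal columns. -/
theorem eigenvalues_compression_mem_Icc {n k : ℕ} {A : Matrix (Fin n) (Fin n) ℂ}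
    (hA : A.IsHermitian) {Q : Matrix (Fin n) (Fin k) ℂ} (hQ : Qᴴ * Q = 1)
    {S : Matrix (Fin k) (Fin k) ℂ} (hS : S.IsHermitian) (hQA : Qᴴ * (A * Q) = S) {a c : ℝ}
    (h : ∀ i, hA.eigenvalues i ∈ Set.Icc a c) (j : Fin k) : hS.eigenvalues j ∈ Set.Icc a c := by
  set v : Fin k → ℂ := ⇑(hS.eigenvectorBasis j) with hv
  set U := (hA.eigenvectorUnitary : Matrix (Fin n) (Fin n) ℂ) with hU
  set y := star U *ᵥ (Q *ᵥ v) with hy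
  have hUU : (star U)ᴴ * star U = 1 := by
    rw [← star_eq_conjTranspose, star_star]
    exact Unitary.coe_mul_star_self _
  have hnorm : ∑ i, ‖y i‖ ^ 2 = 1 := by
    have h1 : ‖WithLp.toLp 2 y‖ = 1 := by
      rw [hy, norm_toLp_mulVec_of_conjTranspose_mul_self hUU,
        norm_toLp_mulVec_of_conjTranspose_mul_self hQ]
      exact hS.eigenvectorBasis.orthonormal.1 j
    have h2 := EuclideanSpace.norm_sq_eq (WithLp.toLp 2 y)
    rw [h1] at h2
    simpa using h2.symm
  have hquad : hS.eigenvalues j = ∑ i, hA.eigenvalues i * ‖y i‖ ^ 2 := by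
    have hAd : A = U * diagonal (RCLike.ofReal ∘ hA.eigenvalues) * star U := by
      conv_lhs => rw [hA.spectral_theorem, Unitary.conjStarAlgAut_apply]
    have h1 : star v ⬝ᵥ (S *ᵥ v) =
        star y ⬝ᵥ (diagonal (RCLike.ofReal ∘ hA.eigenvalues) *ᵥ y) := by
      have hstar : star y = (star v ᵥ* Qᴴ) ᵥ* U := by
        rw [hy, star_mulVec, star_mulVec, ← star_eq_conjTranspose, star_star]
      rw [← hQA, hstar, hy]
      conv_lhs => rw [hAd]
      simp only [dotProduct_mulVec, vecMul_vecMul, Matrix.mul_assoc]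
    rw [hS.eigenvalues_eq, ← hv, h1, dotProduct, map_sum]
    refine Finset.sum_congr rfl fun i _ => ?_
    have h2 : star (y i) * ((hA.eigenvalues i : ℂ) * y i) =
        ((hA.eigenvalues i * ‖y i‖ ^ 2 : ℝ) : ℂ) := by
      have h3 : star (y i) * y i = (‖y i‖ : ℂ) ^ 2 := Complex.conj_mul' (y i)
      push_cast
      rw [← h3]
      ring
    rw [mulVec_diagonal]
    exact (congrArg Complex.re h2).trans (Complex.ofReal_re _)
  rw [hquad]
  constructor
  · calc a = ∑ i, a * ‖y i‖ ^ 2 := by rw [← Finset.mul_sum, hnorm, mul_one]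
      _ ≤ _ := by
        gcongr with i
        exact (h i).1
  · calc _ ≤ ∑ i, c * ‖y i‖ ^ 2 := by
          gcongr with i
          exact (h i).2
      _ = c := by rw [← Finset.mul_sum, hnorm, mul_one]

/-- The residual of the shifted system is a multiple of `q`; the multiplier is given by Cramer's
rule. -/
theorem det_smul_sub_smul_one_mulVec_errK {n k : ℕ} {A : Matrix (Fin n) (Fin n) ℂ}
    {Q : Matrix (Fin n) (Fin k) ℂ} (hQ : Qᴴ * Q = 1) {S : Matrix (Fin k) (Fin k) ℂ}
    {b q : Fin n → ℂ} {β γ : ℂ} {i l : Fin k} (hb : b = γ • Q *ᵥ Pi.single i 1)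
    (hAQ : A * Q = Q * S + β • vecMulVec q (Pi.single l 1)) {z : ℂ}
    (hAz : IsUnit (A - z • 1).det) (hSz : IsUnit (S - z • 1).det) :
    (S - z • 1).det • (A - z • 1) *ᵥ errK A Q S b z =
      -(β * γ * (S - z • 1).adjugate l i) • q := by
  have hQb : Qᴴ *ᵥ b = γ • Pi.single i 1 := by
    rw [hb, mulVec_smul, mulVec_mulVec, hQ, one_mulVec]
  set x := (S - z • 1)⁻¹ *ᵥ (Qᴴ *ᵥ b) with hx
  have hxl : x l = γ * ((S - z • 1).det⁻¹ * (S - z • 1).adjugate l i) := by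
    rw [hx, hQb, mulVec_smul, Matrix.inv_def]
    simp [Ring.inverse_eq_inv']
  have hcomm : (A - z • 1) * Q = Q * (S - z • 1) + β • vecMulVec q (Pi.single l 1) := by
    rw [Matrix.sub_mul, Matrix.mul_sub, hAQ]
    simp
    abel
  have hSx : (S - z • 1) *ᵥ x = γ • Pi.single i 1 := by
    rw [hx, mulVec_mulVec, Matrix.mul_nonsing_inv _ hSz, one_mulVec, hQb]
  have hres : (A - z • 1) *ᵥ (Q *ᵥ x) = b + (β * x l) • q := by
    rw [mulVec_mulVec, hcomm, add_mulVec, ← mulVec_mulVec, hSx, mulVec_smul, ← hb, smul_mulVec,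
      vecMulVec_mulVec, mul_smul]
    simp
  have herr : errK A Q S b z = (A - z • 1)⁻¹ *ᵥ b - Q *ᵥ x := by
    rw [errK, hx, mulVec_mulVec, mulVec_mulVec, Matrix.mul_assoc]
  rw [herr, mulVec_sub, mulVec_mulVec, Matrix.mul_nonsing_inv _ hAz, one_mulVec, hres, hxl,
    sub_add_cancel_left, smul_neg, smul_smul, neg_smul]
  congr 2
  have := hSz.ne_zero
  field_simp

/-- Cauchy's integral formula bounds a combination of values of `f` by the corresponding
combination of resolvents on a circle. -/
theorem norm_sum_smul_le_of_resolvent_bound {ι E : Type*} [Fintype ι] [NormedAddCommGroup E]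
    [NormedSpace ℂ E] [CompleteSpace E] {c : ℂ} {r K : ℝ} {f : ℂ → ℂ} (hr : 0 < r)
    (hf : DifferentiableOn ℂ f (Metric.closedBall c r)) {x : ι → ℂ}
    (hx : ∀ i, x i ∈ Metric.ball c r) (u : ι → E)
    (hK : ∀ z ∈ Metric.sphere c r, ‖∑ i, (x i - z)⁻¹ • u i‖ ≤ K) :
    ‖∑ i, f (x i) • u i‖ ≤ ((2 * Real.pi)⁻¹ *
      ∫ θ in (0 : ℝ)..(2 * Real.pi), ‖f (c + r * Complex.exp (θ * Complex.I))‖ * r) * K := by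
  have hne : ∀ i, ∀ z ∈ Metric.sphere c r, z - x i ≠ 0 := by
    intro i z hz h0
    have h1 := hx i
    rw [← sub_eq_zero.1 h0, Metric.mem_ball, Metric.mem_sphere.1 hz] at h1
    exact lt_irrefl _ h1
  have hfc : ContinuousOn f (Metric.sphere c r) :=
    hf.continuousOn.mono Metric.sphere_subset_closedBall
  have hrep : ∑ i, f (x i) • u i = (2 * Real.pi * Complex.I : ℂ)⁻¹ •
      ∮ z in C(c, r), ∑ i, (z - x i)⁻¹ • f z • u i := by
    rw [circleIntegral.integral_fun_sum, Finset.smul_sum]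
    · refine Finset.sum_congr rfl fun i _ => ?_
      have hd : DifferentiableOn ℂ (fun z => f z • u i) (Metric.closedBall c r) :=
        hf.smul_const (u i)
      rw [hd.circleIntegral_sub_inv_smul (hx i), inv_smul_smul₀]
      simp [Real.pi_ne_zero, Complex.I_ne_zero]
    · intro i _
      refine ContinuousOn.circleIntegrable hr.le ?_
      exact ((continuousOn_id.sub continuousOn_const).inv₀ (hne i)).smul
        (hfc.smul continuousOn_const)
  have hcont : Continuous fun θ : ℝ => ‖f (circleMap c r θ)‖ * r :=
    ((hfc.comp_continuous (continuous_circleMap c r)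
      (circleMap_mem_sphere c hr.le)).norm).mul continuous_const
  have hint : ‖∮ z in C(c, r), ∑ i, (z - x i)⁻¹ • f z • u i‖ ≤
      ∫ θ in (0 : ℝ)..(2 * Real.pi), ‖f (circleMap c r θ)‖ * r * K := by
    refine intervalIntegral.norm_integral_le_of_norm_le Real.two_pi_pos.le
      (Filter.Eventually.of_forall fun θ _ => ?_)
      ((hcont.mul continuous_const).intervalIntegrable _ _)
    have hsum : ∑ i, (circleMap c r θ - x i)⁻¹ • f (circleMap c r θ) • u i =
        -(f (circleMap c r θ) • ∑ i, (x i - circleMap c r θ)⁻¹ • u i) := by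
      rw [Finset.smul_sum, ← Finset.sum_neg_distrib]
      refine Finset.sum_congr rfl fun i _ => ?_
      rw [smul_comm, ← neg_sub, inv_neg, neg_smul, smul_neg]
    beta_reduce
    rw [hsum, norm_smul, norm_neg, norm_smul, deriv_circleMap, norm_mul, norm_circleMap_zero,
      Complex.norm_I, mul_one, abs_of_pos hr]
    calc r * (‖f (circleMap c r θ)‖ * ‖∑ i, (x i - circleMap c r θ)⁻¹ • u i‖)
        ≤ r * (‖f (circleMap c r θ)‖ * K) := by
          gcongr
          exact hK _ (circleMap_mem_sphere c hr.le θ)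
      _ = ‖f (circleMap c r θ)‖ * r * K := by ring
  rw [hrep, norm_smul]
  have hpi : ‖(2 * Real.pi * Complex.I : ℂ)⁻¹‖ = (2 * Real.pi)⁻¹ := by
    simp [abs_of_pos Real.pi_pos]
  rw [hpi, mul_assoc, ← intervalIntegral.integral_mul_const]
  gcongr
  exact hint

theorem integral_norm_circle_le_mul_sSup {c : ℂ} {r : ℝ} {f : ℂ → ℂ} (hr : 0 ≤ r)
    (hf : ContinuousOn f (Metric.sphere c r)) :
    (2 * Real.pi)⁻¹ *
        ∫ θ in (0 : ℝ)..(2 * Real.pi), ‖f (c + r * Complex.exp (θ * Complex.I))‖ * r ≤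
      r * sSup ((fun z : ℂ => ‖f z‖) '' Metric.sphere c r) := by
  have hbdd : BddAbove ((fun z : ℂ => ‖f z‖) '' Metric.sphere c r) :=
    (isCompact_sphere c r).bddAbove_image hf.norm
  have hcont : Continuous fun θ : ℝ => ‖f (circleMap c r θ)‖ * r :=
    ((hf.comp_continuous (continuous_circleMap c r)
      (circleMap_mem_sphere c hr)).norm).mul continuous_const
  have hle : ∫ θ in (0 : ℝ)..(2 * Real.pi), ‖f (circleMap c r θ)‖ * r ≤
      ∫ _ in (0 : ℝ)..(2 * Real.pi), sSup ((fun z : ℂ => ‖f z‖) '' Metric.sphere c r) * r := by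
    refine intervalIntegral.integral_mono_on Real.two_pi_pos.le
      (hcont.intervalIntegrable _ _) (continuous_const.intervalIntegrable _ _) fun θ _ => ?_
    gcongr
    exact le_csSup hbdd ⟨_, circleMap_mem_sphere c hr θ, rfl⟩
  rw [intervalIntegral.integral_const, sub_zero, smul_eq_mul] at hle
  rw [inv_mul_le_iff₀ Real.two_pi_pos, mul_comm r]
  exact hle

/-- The error of the shifted system at `z` is dominated by the error at `w` when every eigenvalue
of `A` and `S` is at least as close to `w` as to `z`. -/
theorem norm_toLp_mulVec_errK_le {n k : ℕ} (hk : 0 < k) {A : Matrix (Fin n) (Fin n) ℂ}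
    (hA : A.IsHermitian) {S : Matrix (Fin k) (Fin k) ℂ} (hS : S.IsHermitian)
    {Q : Matrix (Fin n) (Fin k) ℂ} (hQ : Qᴴ * Q = 1) {b q : Fin n → ℂ} {β γ : ℂ}
    (hb : b = γ • Q *ᵥ Pi.single (⟨0, hk⟩ : Fin k) 1)
    (hAQ : A * Q = Q * S + β •
      vecMulVec q (Pi.single (⟨k - 1, Nat.sub_lt hk Nat.one_pos⟩ : Fin k) 1))
    (hSlow : ∀ i j : Fin k, (j : ℕ) + 1 < (i : ℕ) → S i j = 0)
    {R : Matrix (Fin n) (Fin n) ℂ} (hRA : Commute R A) {w z : ℂ}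
    (hAw : ∀ i, (hA.eigenvalues i : ℂ) - w ≠ 0) (hSw : ∀ j, (hS.eigenvalues j : ℂ) - w ≠ 0)
    (hAwz : ∀ i, ‖(hA.eigenvalues i : ℂ) - w‖ ≤ ‖(hA.eigenvalues i : ℂ) - z‖)
    (hSwz : ∀ j, ‖(hS.eigenvalues j : ℂ) - w‖ ≤ ‖(hS.eigenvalues j : ℂ) - z‖) :
    ‖WithLp.toLp 2 (R *ᵥ errK A Q S b z)‖ ≤ ‖WithLp.toLp 2 (R *ᵥ errK A Q S b w)‖ := by
  have hAz : ∀ i, (hA.eigenvalues i : ℂ) - z ≠ 0 := fun i =>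
    norm_pos_iff.1 ((norm_pos_iff.2 (hAw i)).trans_le (hAwz i))
  have hSz : ∀ j, (hS.eigenvalues j : ℂ) - z ≠ 0 := fun j =>
    norm_pos_iff.1 ((norm_pos_iff.2 (hSw j)).trans_le (hSwz j))
  have uAw := isUnit_det_sub_smul_one hA hAw
  have uAz := isUnit_det_sub_smul_one hA hAz
  have uSw := isUnit_det_sub_smul_one hS hSw
  have uSz := isUnit_det_sub_smul_one hS hSz
  have hdet : ‖(S - w • 1).det‖ ≤ ‖(S - z • 1).det‖ := by
    rw [det_sub_smul_one hS, det_sub_smul_one hS, norm_prod, norm_prod]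
    exact Finset.prod_le_prod (fun _ _ => norm_nonneg _) fun j _ => hSwz j
  have hR : ∀ t : ℂ, R * (A - t • 1) = (A - t • 1) * R := fun t => by
    rw [Matrix.mul_sub, Matrix.sub_mul, hRA.eq]
    simp
  have hAA : (A - w • 1) * (A - z • 1) = (A - z • 1) * (A - w • 1) := by
    rw [sub_smul_one_eq_matFun hA w, sub_smul_one_eq_matFun hA z, matFun_mul, matFun_mul]
    simp only [mul_comm]
  set y := (A - w • 1)⁻¹ *ᵥ errK A Q S b z with hy
  have hwy : (A - w • 1) *ᵥ y = errK A Q S b z := by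
    rw [hy, mulVec_mulVec, Matrix.mul_nonsing_inv _ uAw, one_mulVec]
  have hzy : (S - z • 1).det • (A - z • 1) *ᵥ y = (S - w • 1).det • errK A Q S b w := by
    have h1 := det_smul_sub_smul_one_mulVec_errK hQ hb hAQ uAz uSz
    rw [adjugate_corner_sub_smul_one hk hSlow z w,
      ← det_smul_sub_smul_one_mulVec_errK hQ hb hAQ uAw uSw] at h1
    refine Matrix.mulVec_injective_of_isUnit ((Matrix.isUnit_iff_isUnit_det _).2 uAw) ?_
    simp only [mulVec_smul]
    rw [← h1, mulVec_mulVec, hAA, ← mulVec_mulVec, hwy]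
  have hzy' : (S - z • 1).det • R *ᵥ ((A - z • 1) *ᵥ y) =
      (S - w • 1).det • R *ᵥ errK A Q S b w := by
    rw [← mulVec_smul, hzy, mulVec_smul]
  have hnorm : ‖(S - z • 1).det‖ * ‖WithLp.toLp 2 (R *ᵥ ((A - z • 1) *ᵥ y))‖ =
      ‖(S - w • 1).det‖ * ‖WithLp.toLp 2 (R *ᵥ errK A Q S b w)‖ := by
    rw [← norm_smul, ← norm_smul, ← WithLp.toLp_smul, hzy', WithLp.toLp_smul]
  have hmono : ‖WithLp.toLp 2 (R *ᵥ errK A Q S b z)‖ ≤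
      ‖WithLp.toLp 2 (R *ᵥ ((A - z • 1) *ᵥ y))‖ := by
    rw [← hwy, mulVec_mulVec y R, mulVec_mulVec y R, hR, hR, ← mulVec_mulVec, ← mulVec_mulVec]
    exact norm_toLp_sub_smul_one_mulVec_mono hA hAwz _
  refine hmono.trans (le_of_mul_le_mul_left ?_ (norm_pos_iff.2 uSz.ne_zero))
  rw [hnorm]
  gcongr

theorem exists_eigenvalue_expansion {n k : ℕ} {A : Matrix (Fin n) (Fin n) ℂ}
    (hA : A.IsHermitian) {S : Matrix (Fin k) (Fin k) ℂ} (hS : S.IsHermitian)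
    (Q : Matrix (Fin n) (Fin k) ℂ) (R : Matrix (Fin n) (Fin n) ℂ) (b : Fin n → ℂ) :
    ∃ u : Fin n ⊕ Fin k → EuclideanSpace ℂ (Fin n), ∀ g : ℝ → ℂ,
      WithLp.toLp 2 (R *ᵥ (matFun hA g *ᵥ b - (Q * matFun hS g * Qᴴ) *ᵥ b)) =
        ∑ i, g (Sum.elim hA.eigenvalues hS.eigenvalues i) • u i := by
  refine ⟨Sum.elim
    (fun i => WithLp.toLp 2 (R *ᵥ
      ((star (hA.eigenvectorUnitary : Matrix (Fin n) (Fin n) ℂ) *ᵥ b) i •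
        (hA.eigenvectorUnitary : Matrix (Fin n) (Fin n) ℂ).col i)))
    (fun j => -WithLp.toLp 2 (R *ᵥ (Q *ᵥ
      ((star (hS.eigenvectorUnitary : Matrix (Fin k) (Fin k) ℂ) *ᵥ (Qᴴ *ᵥ b)) j •
        (hS.eigenvectorUnitary : Matrix (Fin k) (Fin k) ℂ).col j)))), fun g => ?_⟩
  rw [← mulVec_mulVec, ← mulVec_mulVec, matFun_mulVec_eq_sum, matFun_mulVec_eq_sum, mulVec_sub,
    WithLp.toLp_sub, Fintype.sum_sum_type]
  simp only [Sum.elim_inl, Sum.elim_inr, mulVec_sum, WithLp.toLp_sum, smul_neg,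
    Finset.sum_neg_distrib, sub_eq_add_neg, mulVec_smul, WithLp.toLp_smul]

theorem norm_sub_le_norm_sub_of_mem_sphere {w L x : ℝ} (hx : x ∈ Set.Ioc w L) {z : ℂ}
    (hz : z ∈ Metric.sphere (L : ℂ) (L - w)) : ‖(x : ℂ) - w‖ ≤ ‖(x : ℂ) - z‖ := by
  rw [mem_sphere_iff_norm] at hz
  have h1 : ‖(x : ℂ) - w‖ = x - w := by
    rw [← Complex.ofReal_sub, Complex.norm_of_nonneg (sub_nonneg.2 hx.1.le)]
  have h2 : ‖(L : ℂ) - x‖ = L - x := by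
    rw [← Complex.ofReal_sub, Complex.norm_of_nonneg (sub_nonneg.2 hx.2)]
  have h3 : ‖z - L‖ ≤ ‖(x : ℂ) - z‖ + ‖(L : ℂ) - x‖ := by
    rw [← norm_neg (z - L)]
    convert norm_add_le ((x : ℂ) - z) ((L : ℂ) - x) using 2
    ring
  linarith

theorem lanczos_fa_disk_bound
    {n k : ℕ} (hn : 0 < n) (hk : 0 < k)
    (A : Matrix (Fin n) (Fin n) ℂ) (hA : A.IsHermitian)
    (b : Fin n → ℂ) (hb : b ≠ 0)
    (Q : Matrix (Fin n) (Fin k) ℂ) (hQ : Qᴴ * Q = 1)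
    (hQb : Q.mulVec (Pi.single (⟨0, hk⟩ : Fin k) 1) = (norm2 b)⁻¹ • b)
    (T : Matrix (Fin k) (Fin k) ℝ) (hTsymm : T.IsSymm)
    (hTtri : ∀ i j : Fin k, (i : ℕ) + 1 < (j : ℕ) ∨ (j : ℕ) + 1 < (i : ℕ) → T i j = 0)
    (hToff : ∀ i j : Fin k, (i : ℕ) + 1 = (j : ℕ) → 0 < T i j)
    (βk : ℝ) (hβk : 0 < βk)
    (q : Fin n → ℂ) (hq : norm2 q = 1) (hQq : Qᴴ.mulVec q = 0)
    (hAQ : A * Q = Q * T.map Complex.ofReal + (βk : ℂ) •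
      Matrix.vecMulVec q (Pi.single (⟨k - 1, Nat.sub_lt hk Nat.one_pos⟩ : Fin k) 1))
    (hTH : (T.map Complex.ofReal).IsHermitian)
    (w : ℝ) (hw : w < ⨅ i, hA.eigenvalues i)
    (f : ℂ → ℂ)
    (hf : ∃ U : Set ℂ, IsOpen U ∧
      Metric.closedBall ((⨆ i, hA.eigenvalues i : ℝ) : ℂ) ((⨆ i, hA.eigenvalues i) - w) ⊆ U ∧
      DifferentiableOn ℂ f U)
    (M : Matrix (Fin n) (Fin n) ℂ) (hM : M.PosDef) (hMA : M * A = A * M) :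
    normM M ((matFun hA fun x : ℝ => f (x : ℂ)).mulVec b -
        (Q * matFun hTH (fun x : ℝ => f (x : ℂ)) * Qᴴ).mulVec b) ≤
      ((2 * Real.pi)⁻¹ *
          ∫ θ in (0 : ℝ)..(2 * Real.pi),
            ‖f (((⨆ i, hA.eigenvalues i : ℝ) : ℂ) +
                ((⨆ i, hA.eigenvalues i) - w : ℝ) * Complex.exp (θ * Complex.I))‖ *
              ((⨆ i, hA.eigenvalues i) - w)) *
        normM M (errK A Q (T.map Complex.ofReal) b (w : ℂ)) ∧
    ((2 * Real.pi)⁻¹ *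
          ∫ θ in (0 : ℝ)..(2 * Real.pi),
            ‖f (((⨆ i, hA.eigenvalues i : ℝ) : ℂ) +
                ((⨆ i, hA.eigenvalues i) - w : ℝ) * Complex.exp (θ * Complex.I))‖ *
              ((⨆ i, hA.eigenvalues i) - w)) *
        normM M (errK A Q (T.map Complex.ofReal) b (w : ℂ)) ≤
      (((⨆ i, hA.eigenvalues i) - w) *
          sSup ((fun z : ℂ => ‖f z‖) ''
            Metric.sphere ((⨆ i, hA.eigenvalues i : ℝ) : ℂ) ((⨆ i, hA.eigenvalues i) - w))) *
        normM M (errK A Q (T.map Complex.ofReal) b (w : ℂ)) := by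
  obtain ⟨U, -, hU, hfU⟩ := hf
  have : Nonempty (Fin n) := ⟨⟨0, hn⟩⟩
  set L := ⨆ i, hA.eigenvalues i
  set S := T.map Complex.ofReal with hS
  set r := L - w
  have hfd : DifferentiableOn ℂ f (Metric.closedBall (L : ℂ) r) := hfU.mono hU
  have hAspec : ∀ i, hA.eigenvalues i ∈ Set.Icc (⨅ i, hA.eigenvalues i) L := fun i =>
    ⟨ciInf_le (Set.finite_range _).bddBelow i, le_ciSup (Set.finite_range _).bddAbove i⟩
  have hQAQ : Qᴴ * (A * Q) = S := by
    rw [hAQ, Matrix.mul_add, ← Matrix.mul_assoc, hQ, Matrix.one_mul, Matrix.mul_smul,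
      mul_vecMulVec, hQq]
    simp
  have hSspec := eigenvalues_compression_mem_Icc hA hQ hTH hQAQ hAspec
  have hAIoc : ∀ i, hA.eigenvalues i ∈ Set.Ioc w L := fun i =>
    ⟨hw.trans_le (hAspec i).1, (hAspec i).2⟩
  have hSIoc : ∀ j, hTH.eigenvalues j ∈ Set.Ioc w L := fun j =>
    ⟨hw.trans_le (hSspec j).1, (hSspec j).2⟩
  have hr0 : 0 < r := sub_pos.2 ((hAIoc ⟨0, hn⟩).1.trans_le (hAIoc ⟨0, hn⟩).2)
  have hsphere : ∀ z ∈ Metric.sphere (L : ℂ) r, ∀ x ∈ Set.Ioc w L,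
      ‖(x : ℂ) - w‖ ≤ ‖(x : ℂ) - z‖ := fun z hz x hx =>
    norm_sub_le_norm_sub_of_mem_sphere hx hz
  have hb' : b = (norm2 b : ℂ) • Q *ᵥ Pi.single (⟨0, hk⟩ : Fin k) 1 := by
    have h0 : norm2 b ≠ 0 := by
      intro h0
      rw [norm2, ← EuclideanSpace.norm_eq (WithLp.toLp 2 b), norm_eq_zero] at h0
      exact hb (congrArg WithLp.ofLp h0)
    rw [hQb, Complex.coe_smul, smul_inv_smul₀ h0]
  have hSlow : ∀ i j : Fin k, (j : ℕ) + 1 < (i : ℕ) → S i j = 0 := by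
    intro i j hij
    simp [hS, hTtri i j (Or.inr hij)]
  obtain ⟨R, hRM, hRA⟩ := exists_conjTranspose_mul_self_commute hM.posSemidef hMA
  have hwne : ∀ x ∈ Set.Ioc w L, (x : ℂ) - w ≠ 0 := fun x hx =>
    sub_ne_zero.2 (Complex.ofReal_injective.ne hx.1.ne')
  have hnz : ∀ z ∈ Metric.sphere (L : ℂ) r, ∀ x ∈ Set.Ioc w L, (x : ℂ) - z ≠ 0 := by
    intro z hz x hx
    exact norm_pos_iff.1 ((norm_pos_iff.2 (hwne x hx)).trans_le (hsphere z hz x hx))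
  have herr : ∀ z ∈ Metric.sphere (L : ℂ) r,
      ‖WithLp.toLp 2 (R *ᵥ errK A Q S b z)‖ ≤ normM M (errK A Q S b w) := by
    intro z hz
    rw [← hRM, ← norm_toLp_mulVec_eq_normM]
    exact norm_toLp_mulVec_errK_le hk hA hTH hQ hb' hAQ hSlow hRA
      (fun i => hwne _ (hAIoc i)) (fun j => hwne _ (hSIoc j))
      (fun i => hsphere z hz _ (hAIoc i)) (fun j => hsphere z hz _ (hSIoc j))
  constructor
  · obtain ⟨u, hu⟩ := exists_eigenvalue_expansion hA hTH Q R b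
    have hx : ∀ i, ((Sum.elim hA.eigenvalues hTH.eigenvalues i : ℝ) : ℂ) ∈
        Metric.ball (L : ℂ) r := by
      have hball : ∀ x ∈ Set.Ioc w L, (x : ℂ) ∈ Metric.ball (L : ℂ) r := by
        intro x hx
        rw [Metric.mem_ball, dist_comm, Complex.dist_of_im_eq (by simp), Complex.ofReal_re,
          Complex.ofReal_re, Real.dist_eq, abs_of_nonneg (sub_nonneg.2 hx.2)]
        linarith [hx.1]
      rintro (i | j)
      · exact hball _ (hAIoc i)
      · exact hball _ (hSIoc j)
    rw [← hRM, ← norm_toLp_mulVec_eq_normM, hu, hRM]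
    refine norm_sum_smul_le_of_resolvent_bound hr0 hfd hx u fun z hz => ?_
    rw [← hu fun x : ℝ => ((x : ℂ) - z)⁻¹,
      ← inv_sub_smul_one_eq_matFun hA fun i => hnz z hz _ (hAIoc i),
      ← inv_sub_smul_one_eq_matFun hTH fun j => hnz z hz _ (hSIoc j)]
    exact herr z hz
  · exact mul_le_mul_of_nonneg_right (integral_norm_circle_le_mul_sSup hr0.le
      (hfd.continuousOn.mono Metric.sphere_subset_closedBall)) (Real.sqrt_nonneg _)
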